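/- arXiv:2010.05414 — 4 statements merged into one kernel-verified Lean document; each statement's English description precedes it below -/
import Mathlib

section
/- Let φ : (0,∞) → (0,∞) be a decreasing function such that 1/φ is doubling. Then for every λ > 2 there is a constant C(λ) > 0 such that for all t > 0 the series ∑_{k=1}^∞ 2^{−k} log φ((λ−1) λ^{−(k+1)} t) converges and ∏_{k=1}^∞ (φ((λ−1) λ^{−(k+1)} t))^{2^{−k}} := exp(∑_{k=1}^∞ 2^{−k} log φ((λ−1) λ^{−(k+1)} t)) ≤ C(λ) φ(t). -/
open Set

/-- If `φ : (0,∞) → (0,∞)` is decreasing and `1/φ` is doubling, then for every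
`λ > 2` there is `C(λ) > 0` such that for all `t > 0` the series
`∑_{k=1}^∞ 2^{−k} log φ((λ−1) λ^{−(k+1)} t)` converges and
`∏_{k=1}^∞ φ((λ−1) λ^{−(k+1)} t)^{2^{−k}} = exp(∑ …) ≤ C(λ) φ(t)`.
(Here the index `k : ℕ` below corresponds to `k + 1 ≥ 1` in the product.) -/
theorem statement2 (φ : ℝ → ℝ) (hpos : ∀ r > 0, 0 < φ r) (hdec : AntitoneOn φ (Ioi 0))
    (hdoub : ∃ c > 0, ∀ r > 0, 1 / φ (2 * r) ≤ c * (1 / φ r)) :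
    ∀ lam : ℝ, 2 < lam → ∃ C > 0, ∀ t > 0,
      Summable (fun k : ℕ =>
        ((2 : ℝ) ^ (k + 1))⁻¹ * Real.log (φ ((lam - 1) * (lam ^ (k + 2))⁻¹ * t))) ∧
      Real.exp (∑' k : ℕ,
          ((2 : ℝ) ^ (k + 1))⁻¹ * Real.log (φ ((lam - 1) * (lam ^ (k + 2))⁻¹ * t)))
        ≤ C * φ t := by
  obtain ⟨c, hc, hd⟩ := hdoub
  have hd1 : ∀ r > 0, φ r ≤ c * φ (2 * r) := by
    intro r hr
    have h := hd r hr
    have h1 := hpos r hr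
    have h2 := hpos (2 * r) (by positivity)
    rw [mul_one_div, div_le_div_iff₀ h2 h1] at h
    linarith
  have hc1 : 1 ≤ c := by
    have h := hd1 1 one_pos
    have h2 := hpos (2 * 1) (by norm_num)
    have h3 : φ (2 * 1) ≤ φ 1 := hdec (by simp) (by simp) (by norm_num)
    by_contra hlt
    push Not at hlt
    nlinarith
  have hdn : ∀ n : ℕ, ∀ r > 0, φ r ≤ c ^ n * φ (2 ^ n * r) := by
    intro n
    induction n with
    | zero => intro r hr; simp
    | succ n ih =>
      intro r hr
      have h1 := ih r hr
      have h2 := hd1 (2 ^ n * r) (by positivity)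
      calc φ r ≤ c ^ n * φ (2 ^ n * r) := h1
        _ ≤ c ^ n * (c * φ (2 * (2 ^ n * r))) := by gcongr
        _ = c ^ (n + 1) * φ (2 ^ (n + 1) * r) := by
          rw [show 2 * (2 ^ n * r) = 2 ^ (n + 1) * r by ring]; ring
  intro lam hlam
  obtain ⟨m, hm⟩ := pow_unbounded_of_one_lt lam (one_lt_two : (1 : ℝ) < 2)
  have hw : HasSum (fun k : ℕ => ((2 : ℝ) ^ (k + 1))⁻¹) 1 := by
    have h := hasSum_geometric_two' 1
    convert h using 2 with k
    rw [pow_succ]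
    field_simp
  set M : ℝ := m * Real.log c with hM
  have hS : Summable (fun k : ℕ => ((2 : ℝ) ^ (k + 1))⁻¹ * ((k + 2) * M)) := by
    have h1 : Summable (fun k : ℕ => (k : ℝ) ^ 1 * (1 / 2 : ℝ) ^ k) :=
      summable_pow_mul_geometric_of_norm_lt_one 1 (by norm_num)
    have h2 := (h1.mul_right (M / 2)).add (hw.summable.mul_right (2 * M))
    refine h2.congr fun k => ?_
    rw [one_div, inv_pow, pow_succ (2 : ℝ) k, mul_inv]
    ring
  refine ⟨Real.exp (∑' k : ℕ, ((2 : ℝ) ^ (k + 1))⁻¹ * ((k + 2) * M)), Real.exp_pos _, ?_⟩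
  intro t ht
  have hbd : ∀ k : ℕ, 0 ≤ Real.log (φ ((lam - 1) * (lam ^ (k + 2))⁻¹ * t)) - Real.log (φ t) ∧
      Real.log (φ ((lam - 1) * (lam ^ (k + 2))⁻¹ * t)) - Real.log (φ t) ≤ (k + 2) * M := by
    intro k
    have hl0 : 0 < lam := by linarith
    have hl1 : 0 < lam - 1 := by linarith
    have hP : 0 < lam ^ (k + 2) := by positivity
    set a := (lam - 1) * (lam ^ (k + 2))⁻¹ with ha
    have ha0 : 0 < a := by positivity
    have hat : 0 < a * t := by positivity
    have ha1 : a ≤ 1 := by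
      rw [ha, ← div_eq_mul_inv, div_le_one hP]
      have : lam ≤ lam ^ (k + 2) := le_self_pow₀ (by linarith) (by omega)
      linarith
    have h1 : φ t ≤ φ (a * t) := hdec (mem_Ioi.2 hat) (mem_Ioi.2 ht) (by nlinarith)
    have h2 := hdn (m * (k + 2)) (a * t) hat
    have h3 : 1 ≤ 2 ^ (m * (k + 2)) * a := by
      have : lam ^ (k + 2) ≤ 2 ^ (m * (k + 2)) := by
        rw [pow_mul]; gcongr
      calc (1 : ℝ) ≤ lam - 1 := by linarith
        _ = lam ^ (k + 2) * a := by rw [ha]; field_simp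
        _ ≤ _ := by gcongr
    have h4 : φ (2 ^ (m * (k + 2)) * (a * t)) ≤ φ t :=
      hdec (mem_Ioi.2 ht) (mem_Ioi.2 (by positivity)) (by nlinarith)
    have h5 : φ (a * t) ≤ c ^ (m * (k + 2)) * φ t := h2.trans (by gcongr)
    have hp := hpos t ht
    constructor
    · exact sub_nonneg.2 (Real.log_le_log hp h1)
    · have h6 := Real.log_le_log (hpos _ hat) h5
      rw [Real.log_mul (by positivity) hp.ne', Real.log_pow] at h6
      push_cast at h6
      rw [hM]
      linarith
  have hD : Summable (fun k : ℕ => ((2 : ℝ) ^ (k + 1))⁻¹ *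
      (Real.log (φ ((lam - 1) * (lam ^ (k + 2))⁻¹ * t)) - Real.log (φ t))) :=
    Summable.of_nonneg_of_le (fun k => mul_nonneg (by positivity) (hbd k).1)
      (fun k => mul_le_mul_of_nonneg_left (hbd k).2 (by positivity)) hS
  have hle := hD.tsum_le_tsum
    (fun k => mul_le_mul_of_nonneg_left (hbd k).2 (by positivity)) hS
  have hF : HasSum (fun k : ℕ =>
        ((2 : ℝ) ^ (k + 1))⁻¹ * Real.log (φ ((lam - 1) * (lam ^ (k + 2))⁻¹ * t)))
      ((∑' k : ℕ, ((2 : ℝ) ^ (k + 1))⁻¹ *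
      (Real.log (φ ((lam - 1) * (lam ^ (k + 2))⁻¹ * t)) - Real.log (φ t)))
        + 1 * Real.log (φ t)) := by
      convert hD.hasSum.add (hw.mul_right (Real.log (φ t))) using 2 with k
      ring
  refine ⟨hF.summable, ?_⟩
  rw [hF.tsum_eq, Real.exp_add, one_mul, Real.exp_log (hpos t ht)]
  have := hpos t ht
  gcongr
end

section
/- Let φ : (0,∞) → (0,∞) be a decreasing function such that lim_{r→0} φ(r) = ∞, lim_{r→∞} φ(r) = 0, and 1/φ is doubling. Then there exist a regular function φ̄ : (0,∞) → (0,∞) and a constant c ≥ 1 such that c⁻¹ φ̄(r) ≤ φ(r) ≤ c φ̄(r) for all r > 0. -/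
open Set

/-- A strictly decreasing `C¹` function `φ̄ : (0,∞) → (0,∞)` is *regular* if:
(i) `φ̄(0+) = ∞` and `φ̄(∞) = 0`;
(ii) there are `c ≥ 1` and a decreasing positive `N` with `c⁻¹ N(t) ≤ M'(t) ≤ c N(t)`,
where `M(t) = −log φ̄(t)`, and `c₀ > 0` with `M'(t) ≤ c₀ M'(at)` for `t > 0`, `a ∈ [1,2]`;
(iii) for every sufficiently large `λ > 2` there are `c(λ), C(λ) > 0` with
`∏_{k=1}^∞ φ̄((λ−1)λ^{−(k+1)}t)^{2^{−k}} ≤ C(λ) φ̄(c(λ) t)` for all `t > 0`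
(the infinite product interpreted via the convergent series of logarithms). -/
def IsRegularDecay (φb : ℝ → ℝ) : Prop :=
  StrictAntiOn φb (Ioi 0) ∧ (∀ r > 0, 0 < φb r) ∧
  (∀ r > 0, DifferentiableAt ℝ φb r) ∧ ContinuousOn (deriv φb) (Ioi 0) ∧
  Filter.Tendsto φb (nhdsWithin 0 (Ioi 0)) Filter.atTop ∧
  Filter.Tendsto φb Filter.atTop (nhds 0) ∧
  (∃ c ≥ (1 : ℝ), ∃ N : ℝ → ℝ, (∀ t > 0, 0 < N t) ∧ AntitoneOn N (Ioi 0) ∧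
    ∀ t > 0, c⁻¹ * N t ≤ deriv (fun s => -Real.log (φb s)) t ∧
      deriv (fun s => -Real.log (φb s)) t ≤ c * N t) ∧
  (∃ c₀ > (0 : ℝ), ∀ t > 0, ∀ a ∈ Icc (1 : ℝ) 2,
    deriv (fun s => -Real.log (φb s)) t ≤ c₀ * deriv (fun s => -Real.log (φb s)) (a * t)) ∧
  (∃ lam₀ > (2 : ℝ), ∀ lam ≥ lam₀, ∃ clam > (0 : ℝ), ∃ Clam > (0 : ℝ), ∀ t > 0,
    Summable (fun k : ℕ =>
      ((2 : ℝ) ^ (k + 1))⁻¹ * Real.log (φb ((lam - 1) * (lam ^ (k + 2))⁻¹ * t))) ∧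
    Real.exp (∑' k : ℕ,
        ((2 : ℝ) ^ (k + 1))⁻¹ * Real.log (φb ((lam - 1) * (lam ^ (k + 2))⁻¹ * t)))
      ≤ Clam * φb (clam * t))

/-- Monotone with square-root-controlled growth. -/
def SlowG (M : ℝ → ℝ) (A : ℝ) : Prop :=
  MonotoneOn M (Ioi 0) ∧ ∀ s t, 0 < s → s ≤ t → M t - M s ≤ A * (t / s) ^ (1/2 : ℝ)

lemma SlowG.nonneg {M : ℝ → ℝ} {A : ℝ} (h : SlowG M A) : 0 ≤ A := by
  have := h.2 1 1 one_pos le_rfl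
  simpa using this

lemma SlowG.scale {M : ℝ → ℝ} {A : ℝ} (h : SlowG M A) {t : ℝ} (ht : 0 < t) :
    SlowG (fun x => M (t * x)) A := by
  refine ⟨fun x hx y hy hxy => h.1 (mul_pos ht hx) (mul_pos ht hy)
    (mul_le_mul_of_nonneg_left hxy ht.le), fun s u hs hsu => ?_⟩
  have := h.2 (t * s) (t * u) (mul_pos ht hs) (mul_le_mul_of_nonneg_left hsu ht.le)
  rwa [mul_div_mul_left _ _ ht.ne'] at this

lemma SlowG.near {M M1 : ℝ → ℝ} {A K : ℝ} (h : SlowG M A) (hm : MonotoneOn M1 (Ioi 0))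
    (hK : ∀ t > 0, |M1 t - M t| ≤ K) : SlowG M1 (A + 2 * K) := by
  refine ⟨hm, fun s t hs hst => ?_⟩
  have h1 := abs_le.1 (hK s hs)
  have h2 := abs_le.1 (hK t (hs.trans_le hst))
  have h3 := h.2 s t hs hst
  have h4 : (1:ℝ) ≤ (t / s) ^ (1/2 : ℝ) := Real.one_le_rpow ((one_le_div hs).2 hst) (by norm_num)
  nlinarith

lemma SlowG.ii {M : ℝ → ℝ} {A : ℝ} (h : SlowG M A) {b : ℝ} (hb : 0 < b) :
    IntervalIntegrable M MeasureTheory.volume 0 b := by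
  have hA := h.nonneg
  have hg : IntervalIntegrable (fun x : ℝ => |M b| + A * b ^ (1/2 : ℝ) * x ^ (-(1/2) : ℝ))
      MeasureTheory.volume 0 b :=
    intervalIntegrable_const.add ((intervalIntegral.intervalIntegrable_rpow' (by norm_num)).const_mul _)
  rw [intervalIntegrable_iff_integrableOn_Ioc_of_le hb.le] at hg ⊢
  refine MeasureTheory.Integrable.mono' hg
    (aemeasurable_restrict_of_monotoneOn measurableSet_Ioc
      (h.1.mono fun x hx => hx.1)).aestronglyMeasurable ?_
  refine (MeasureTheory.ae_restrict_iff' measurableSet_Ioc).2 (Filter.Eventually.of_forall ?_)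
  intro x hx
  have h1 := h.2 x b hx.1 hx.2
  have h2 := h.1 hx.1 hb hx.2
  have e : (b / x) ^ (1/2 : ℝ) = b ^ (1/2 : ℝ) * x ^ (-(1/2) : ℝ) := by
    rw [Real.div_rpow hb.le hx.1.le, Real.rpow_neg hx.1.le, div_eq_mul_inv]
  rw [e, ← mul_assoc] at h1
  rw [Real.norm_eq_abs, abs_le]
  have h3 := neg_abs_le (M b)
  have h4 := le_abs_self (M b)
  have h5 : 0 ≤ A * b ^ (1/2 : ℝ) * x ^ (-(1/2) : ℝ) := by
    have := hx.1
    positivity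
  constructor <;> linarith

/-- The backward average. -/
noncomputable def avg (M : ℝ → ℝ) (t : ℝ) : ℝ := ∫ x in (0:ℝ)..1, M (t * x)

lemma avg_mono {M : ℝ → ℝ} {A : ℝ} (h : SlowG M A) : MonotoneOn (avg M) (Ioi 0) := by
  intro s hs t ht hst
  refine intervalIntegral.integral_mono_on_of_le_Ioo zero_le_one ((h.scale hs).ii one_pos)
    ((h.scale ht).ii one_pos) fun x hx => ?_
  exact h.1 (mul_pos hs hx.1) (mul_pos ht hx.1) (mul_le_mul_of_nonneg_right hst hx.1.le)

lemma avg_near {M : ℝ → ℝ} {A : ℝ} (h : SlowG M A) {t : ℝ} (ht : 0 < t) :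
    |avg M t - M t| ≤ 2 * A := by
  have hi := (h.scale ht).ii one_pos
  have h1 : avg M t ≤ M t := by
    have : avg M t ≤ ∫ x in (0:ℝ)..1, M t :=
      intervalIntegral.integral_mono_on_of_le_Ioo zero_le_one hi intervalIntegrable_const
        fun x hx => h.1 (mul_pos ht hx.1) ht (by nlinarith [hx.2])
    simpa using this
  have h2 : M t - 2 * A ≤ avg M t := by
    have hi2 : IntervalIntegrable (fun x : ℝ => A * x ^ (-(1/2) : ℝ))
        MeasureTheory.volume 0 1 :=
      ((intervalIntegral.intervalIntegrable_rpow' (by norm_num)).const_mul _)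
    have : ∫ x in (0:ℝ)..1, (M t - A * x ^ (-(1/2) : ℝ)) ≤ avg M t := by
      refine intervalIntegral.integral_mono_on_of_le_Ioo zero_le_one
        (intervalIntegrable_const.sub hi2) hi fun x hx => ?_
      have := h.2 (t * x) t (mul_pos ht hx.1) (by nlinarith [hx.2])
      have e : (t / (t * x)) ^ (1/2 : ℝ) = x ^ (-(1/2) : ℝ) := by
        rw [div_mul_cancel_left₀ ht.ne', Real.inv_rpow hx.1.le, Real.rpow_neg hx.1.le]
      rw [e] at this
      linarith
    rw [intervalIntegral.integral_sub intervalIntegrable_const hi2,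
      intervalIntegral.integral_const_mul, integral_rpow (Or.inl (by norm_num))] at this
    norm_num at this
    linarith
  rw [abs_le]
  have := h.nonneg
  constructor <;> linarith

lemma avg_cont {M : ℝ → ℝ} {A : ℝ} (h : SlowG M A) : ContinuousOn (avg M) (Ioi 0) := by
  intro t ht
  have ht' : (0:ℝ) < t := ht
  refine ContinuousAt.continuousWithinAt ?_
  have hc := intervalIntegral.continuousOn_primitive_interval (μ := MeasureTheory.volume) (f := M)
    (a := 0) (b := 2 * t) (by
      have := h.ii (b := 2 * t) (by linarith)
      rwa [intervalIntegrable_iff'] at this)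
  have hc' := hc.continuousAt (x := t) (by
    rw [uIcc_of_le (by linarith)]; exact Icc_mem_nhds ht' (by linarith))
  have : ContinuousAt (fun x => x⁻¹ * ∫ y in (0:ℝ)..x, M y) t :=
    (continuousAt_id.inv₀ ht'.ne').mul hc'
  refine this.congr ?_
  filter_upwards [Ioi_mem_nhds ht'] with x hx
  rw [avg, intervalIntegral.integral_comp_mul_left _ (ne_of_gt hx)]
  simp

lemma avg_scaling {M : ℝ → ℝ} {A : ℝ} (h : SlowG M A) {t a : ℝ} (ht : 0 < t) (ha : 1 ≤ a) :
    avg M (a * t) - avg M t ≤ a * (avg M (a * (a * t)) - avg M (a * t)) := by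
  have ha0 : 0 < a := by linarith
  have hat : 0 < a * t := by positivity
  have key : ∀ u > 0, a * avg M (a * u) = ∫ y in (0:ℝ)..a, M (u * y) := by
    intro u hu
    have := intervalIntegral.integral_comp_mul_left (a := 0) (b := 1) (fun y => M (u * y)) ha0.ne'
    simp only [mul_zero, mul_one, smul_eq_mul] at this
    rw [avg, ← mul_inv_cancel_left₀ ha0.ne' (∫ y in (0:ℝ)..a, M (u * y)), ← this]
    congr 2
    ext x
    ring_nf
  have hi1 := (h.scale ht).ii ha0
  have hi2 := (h.scale hat).ii ha0
  have hj1 := (h.scale ht).ii one_pos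
  have hj2 := (h.scale hat).ii one_pos
  rw [mul_sub, key _ hat, key _ ht, ← intervalIntegral.integral_sub hi2 hi1, avg, avg,
    ← intervalIntegral.integral_sub hj2 hj1,
    ← intervalIntegral.integral_add_adjacent_intervals (hj2.sub hj1)
      ((hj2.sub hj1).symm.trans (hi2.sub hi1))]
  have : 0 ≤ ∫ x in (1:ℝ)..a, (M (a * t * x) - M (t * x)) := by
    refine intervalIntegral.integral_nonneg ha fun x hx => ?_
    have hx0 : 0 < x := by linarith [hx.1]
    refine sub_nonneg.2 (h.1 (mul_pos ht hx0) (mul_pos hat hx0) ?_)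
    nlinarith [mul_pos ht hx0]
  linarith

lemma sq_int {t : ℝ} (ht : 0 < t) :
    MeasureTheory.IntegrableOn (fun s : ℝ => s ^ (-2 : ℝ)) (Ioi t) :=
  integrableOn_Ioi_rpow_of_lt (by norm_num) ht

lemma sq_val {t : ℝ} (ht : 0 < t) : ∫ s in Ioi t, s ^ (-2 : ℝ) = t⁻¹ := by
  rw [integral_Ioi_rpow_of_lt (by norm_num) ht]
  norm_num
  exact Real.rpow_neg_one t

lemma SlowG.bd {M : ℝ → ℝ} {A : ℝ} (h : SlowG M A) {t s : ℝ} (ht : 0 < t) (hs : t ≤ s) :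
    (M s - M t) * s ^ (-2 : ℝ) ≤ A * t ^ (-(1/2) : ℝ) * s ^ (-(3/2) : ℝ) := by
  have hs0 : 0 < s := ht.trans_le hs
  have h1 := h.2 t s ht hs
  have e : A * t ^ (-(1/2) : ℝ) * s ^ (-(3/2) : ℝ) = A * (s / t) ^ (1/2 : ℝ) * s ^ (-2 : ℝ) := by
    rw [Real.div_rpow hs0.le ht.le, Real.rpow_neg ht.le,
      show (-(3/2) : ℝ) = 1/2 + (-2) by norm_num, Real.rpow_add hs0]
    ring
  rw [e]
  exact mul_le_mul_of_nonneg_right h1 (by positivity)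

lemma SlowG.int {M : ℝ → ℝ} {A : ℝ} (h : SlowG M A) {t : ℝ} (ht : 0 < t) :
    MeasureTheory.IntegrableOn (fun s : ℝ => (M s - M t) * s ^ (-2 : ℝ)) (Ioi t) := by
  have hg : MeasureTheory.IntegrableOn
      (fun s : ℝ => A * t ^ (-(1/2) : ℝ) * s ^ (-(3/2) : ℝ)) (Ioi t) :=
    (integrableOn_Ioi_rpow_of_lt (by norm_num) ht).const_mul _
  refine MeasureTheory.Integrable.mono' hg ?_ ?_
  · refine AEMeasurable.aestronglyMeasurable (AEMeasurable.mul ?_ ?_)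
    · exact (aemeasurable_restrict_of_monotoneOn measurableSet_Ioi
        (h.1.mono (Ioi_subset_Ioi ht.le))).sub_const _
    · exact (measurable_id.pow_const _).aemeasurable
  · refine (MeasureTheory.ae_restrict_iff' measurableSet_Ioi).2 (Filter.Eventually.of_forall ?_)
    intro s hs
    have hs' : t < s := hs
    have hs0 : 0 < s := ht.trans hs'
    rw [Real.norm_eq_abs, abs_of_nonneg]
    · exact h.bd ht hs'.le
    · exact mul_nonneg (sub_nonneg.2 (h.1 ht hs0 hs'.le)) (by positivity)

lemma SlowG.int' {M : ℝ → ℝ} {A : ℝ} (h : SlowG M A) {t : ℝ} (ht : 0 < t) :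
    MeasureTheory.IntegrableOn (fun s : ℝ => M s * s ^ (-2 : ℝ)) (Ioi t) := by
  refine ((h.int ht).add ((sq_int ht).const_mul (M t))).congr
    (Filter.Eventually.of_forall fun s => ?_)
  simp only [Pi.add_apply]
  ring

/-- The forward average. -/
noncomputable def fwd (M : ℝ → ℝ) (t : ℝ) : ℝ := t * ∫ s in Ioi t, M s * s ^ (-2 : ℝ)

/-- The derivative of the forward average. -/
noncomputable def fwdN (M : ℝ → ℝ) (t : ℝ) : ℝ := ∫ s in Ioi t, (M s - M t) * s ^ (-2 : ℝ)

lemma int_sub {M : ℝ → ℝ} {A : ℝ} (h : SlowG M A) {t : ℝ} (ht : 0 < t) (c : ℝ) :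
    MeasureTheory.IntegrableOn (fun s : ℝ => (M s - c) * s ^ (-2 : ℝ)) (Ioi t) ∧
    ∫ s in Ioi t, (M s - c) * s ^ (-2 : ℝ) = (∫ s in Ioi t, M s * s ^ (-2 : ℝ)) - c * t⁻¹ := by
  have e : (fun s : ℝ => (M s - c) * s ^ (-2 : ℝ)) =
      fun s => M s * s ^ (-2 : ℝ) - c * s ^ (-2 : ℝ) := by ext s; ring
  rw [e]
  refine ⟨(h.int' ht).sub ((sq_int ht).const_mul c), ?_⟩
  rw [MeasureTheory.integral_sub (h.int' ht) ((sq_int ht).const_mul c),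
    MeasureTheory.integral_const_mul, sq_val ht]

lemma fwdN_eq {M : ℝ → ℝ} {A : ℝ} (h : SlowG M A) {t : ℝ} (ht : 0 < t) :
    fwdN M t = (∫ s in Ioi t, M s * s ^ (-2 : ℝ)) - M t * t⁻¹ := (int_sub h ht _).2

lemma int_hasDeriv {M : ℝ → ℝ} {A : ℝ} (h : SlowG M A) (hc : ContinuousOn M (Ioi 0))
    {t : ℝ} (ht : 0 < t) :
    HasDerivAt (fun t => ∫ s in Ioi t, M s * s ^ (-2 : ℝ)) (-(M t * t ^ (-2 : ℝ))) t := by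
  have hcf : ContinuousOn (fun s : ℝ => M s * s ^ (-2 : ℝ)) (Ioi 0) := by
    refine hc.mul (fun x hx => ?_)
    exact (Real.continuousAt_rpow_const x _ (Or.inl (ne_of_gt hx))).continuousWithinAt
  have hi : IntervalIntegrable (fun s : ℝ => M s * s ^ (-2 : ℝ)) MeasureTheory.volume 1 t := by
    refine (hcf.mono ?_).intervalIntegrable
    intro x hx
    rw [mem_uIcc] at hx
    rcases hx with hx | hx
    · exact lt_of_lt_of_le one_pos hx.1
    · exact lt_of_lt_of_le ht hx.1
  have hd := intervalIntegral.integral_hasDerivAt_right hi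
    (hcf.stronglyMeasurableAtFilter isOpen_Ioi t ht) (hcf.continuousAt (Ioi_mem_nhds ht))
  refine (hd.const_sub (∫ s in Ioi 1, M s * s ^ (-2 : ℝ))).congr_of_eventuallyEq ?_
  filter_upwards [Ioi_mem_nhds ht] with u hu
  have := intervalIntegral.integral_interval_add_Ioi (h.int' one_pos) (h.int' hu)
  linarith

lemma fwd_hasDeriv {M : ℝ → ℝ} {A : ℝ} (h : SlowG M A) (hc : ContinuousOn M (Ioi 0))
    {t : ℝ} (ht : 0 < t) : HasDerivAt (fwd M) (fwdN M t) t := by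
  refine ((hasDerivAt_id t).mul (int_hasDeriv h hc ht)).congr_deriv ?_
  rw [fwdN_eq h ht, Real.rpow_neg ht.le]
  norm_num
  field_simp
  ring

lemma fwdN_cont {M : ℝ → ℝ} {A : ℝ} (h : SlowG M A) (hc : ContinuousOn M (Ioi 0)) :
    ContinuousOn (fwdN M) (Ioi 0) := by
  have : ContinuousOn (fun t => (∫ s in Ioi t, M s * s ^ (-2 : ℝ)) - M t * t⁻¹) (Ioi 0) := by
    refine ContinuousOn.sub (fun t ht => (int_hasDeriv h hc ht).continuousAt.continuousWithinAt)
      (hc.mul (continuousOn_id.inv₀ fun x hx => ne_of_gt hx))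
  exact this.congr fun t ht => fwdN_eq h ht

lemma nn {M : ℝ → ℝ} {A : ℝ} (h : SlowG M A) {t : ℝ} (ht : 0 < t) :
    0 ≤ᵐ[MeasureTheory.volume.restrict (Ioi t)] (fun s : ℝ => (M s - M t) * s ^ (-2 : ℝ)) := by
  refine (MeasureTheory.ae_restrict_iff' measurableSet_Ioi).2 (Filter.Eventually.of_forall ?_)
  intro s hs
  have hs' : t < s := hs
  have hs0 : 0 < s := ht.trans hs'
  exact mul_nonneg (sub_nonneg.2 (h.1 ht hs0 hs'.le)) (by positivity)

lemma fwdN_anti {M : ℝ → ℝ} {A : ℝ} (h : SlowG M A) : AntitoneOn (fwdN M) (Ioi 0) := by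
  intro t ht u hu htu
  have ht' : 0 < t := ht
  have hu' : 0 < u := hu
  calc fwdN M u ≤ ∫ s in Ioi u, (M s - M t) * s ^ (-2 : ℝ) := by
        refine MeasureTheory.setIntegral_mono_on (h.int hu) (int_sub h hu _).1
          measurableSet_Ioi fun s hs => ?_
        have hs0 : 0 < s := hu'.trans hs
        have := h.1 ht hu htu
        exact mul_le_mul_of_nonneg_right (by linarith) (by positivity)
    _ ≤ fwdN M t := MeasureTheory.setIntegral_mono_set (h.int ht) (nn h ht)
        (Ioi_subset_Ioi htu).eventuallyLE

lemma fwdN_lower {M : ℝ → ℝ} {A : ℝ} (h : SlowG M A) {t T : ℝ} (ht : 0 < t) (hT : t ≤ T) :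
    (M T - M t) * T⁻¹ ≤ fwdN M t := by
  have hT0 : 0 < T := ht.trans_le hT
  calc (M T - M t) * T⁻¹ = ∫ s in Ioi T, (M T - M t) * s ^ (-2 : ℝ) := by
        rw [MeasureTheory.integral_const_mul, sq_val hT0]
    _ ≤ ∫ s in Ioi T, (M s - M t) * s ^ (-2 : ℝ) := by
        refine MeasureTheory.setIntegral_mono_on ((sq_int hT0).const_mul _) (int_sub h hT0 _).1
          measurableSet_Ioi fun s hs => ?_
        have hs' : T < s := hs
        have hs0 : 0 < s := hT0.trans hs
        have := h.1 hT0 hs0 hs'.le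
        exact mul_le_mul_of_nonneg_right (by linarith) (by positivity)
    _ ≤ fwdN M t := MeasureTheory.setIntegral_mono_set (h.int ht) (nn h ht)
        (Ioi_subset_Ioi hT).eventuallyLE

lemma fwd_near {M : ℝ → ℝ} {A : ℝ} (h : SlowG M A) {t : ℝ} (ht : 0 < t) :
    |fwd M t - M t| ≤ 2 * A := by
  have e : fwd M t - M t = t * fwdN M t := by
    rw [fwdN_eq h ht, fwd]; field_simp
  have h0 : 0 ≤ fwdN M t := by
    have := fwdN_lower h ht le_rfl
    simpa using this
  have h1 : fwdN M t ≤ ∫ s in Ioi t, A * t ^ (-(1/2) : ℝ) * s ^ (-(3/2) : ℝ) :=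
    MeasureTheory.setIntegral_mono_on (h.int ht)
      ((integrableOn_Ioi_rpow_of_lt (by norm_num) ht).const_mul _) measurableSet_Ioi
      fun s hs => h.bd ht (le_of_lt hs)
  rw [MeasureTheory.integral_const_mul, integral_Ioi_rpow_of_lt (by norm_num) ht] at h1
  rw [e, abs_of_nonneg (by positivity)]
  have h2 : t ^ (-(1/2) : ℝ) * t ^ (-(1/2) : ℝ) = t⁻¹ := by
    rw [← Real.rpow_add ht]; norm_num; exact Real.rpow_neg_one t
  have h3 : A * t ^ (-(1/2) : ℝ) * (-t ^ (-(3/2) + 1 : ℝ) / (-(3/2) + 1)) = 2 * A * t⁻¹ := by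
    rw [← h2]; norm_num; ring
  rw [h3] at h1
  calc t * fwdN M t ≤ t * (2 * A * t⁻¹) := mul_le_mul_of_nonneg_left h1 ht.le
    _ = 2 * A := by field_simp

lemma fwdN_doub {M : ℝ → ℝ} {A : ℝ} (h : SlowG M A)
    (hsc : ∀ t > 0, ∀ a ≥ 1, M (a * t) - M t ≤ a * (M (a * (a * t)) - M (a * t)))
    {t a : ℝ} (ht : 0 < t) (ha : a ∈ Icc (1:ℝ) 2) : fwdN M t ≤ 9 * fwdN M (a * t) := by
  obtain ⟨ha1, ha2⟩ := ha
  have ha0 : 0 < a := by linarith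
  have hb : 0 < a * t := by positivity
  have htb : t ≤ a * t := by nlinarith
  have hN0 : 0 ≤ fwdN M (a * t) := by
    have := fwdN_lower h hb le_rfl
    simpa using this
  have hii : IntervalIntegrable (fun s : ℝ => s ^ (-2 : ℝ)) MeasureTheory.volume t (a * t) := by
    rw [intervalIntegrable_iff_integrableOn_Ioc_of_le htb]
    exact (sq_int ht).mono_set Ioc_subset_Ioi_self
  have hii2 : IntervalIntegrable (fun s : ℝ => M s * s ^ (-2 : ℝ)) MeasureTheory.volume t (a * t) := by
    rw [intervalIntegrable_iff_integrableOn_Ioc_of_le htb]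
    exact (h.int' ht).mono_set Ioc_subset_Ioi_self
  have h1 : ∫ s in t..(a * t), M s * s ^ (-2 : ℝ) ≤ M (a * t) * (t⁻¹ - (a * t)⁻¹) := by
    have e := intervalIntegral.integral_interval_add_Ioi (sq_int ht) (sq_int hb)
    rw [sq_val ht, sq_val hb] at e
    rw [← e, add_sub_cancel_right, ← intervalIntegral.integral_const_mul]
    refine intervalIntegral.integral_mono_on htb hii2 (hii.const_mul _) fun s hs => ?_
    have hs0 : 0 < s := ht.trans_le hs.1
    exact mul_le_mul_of_nonneg_right (h.1 hs0 hb hs.2) (by positivity)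
  have h2 := intervalIntegral.integral_interval_add_Ioi (h.int' ht) (h.int' hb)
  have h3 := fwdN_eq h ht
  have h4 := fwdN_eq h hb
  have h5 : fwdN M t - fwdN M (a * t) ≤ (M (a * t) - M t) * t⁻¹ := by
    rw [h3, h4]; linarith
  have h6 := hsc t ht a ha1
  have h7 := fwdN_lower h hb (show a * t ≤ a * (a * t) by nlinarith)
  have h8 : (M (a * (a * t)) - M (a * t)) ≤ a * (a * t) * fwdN M (a * t) := by
    rw [← div_eq_mul_inv, div_le_iff₀ (by positivity)] at h7
    linarith
  have h9 : (M (a * t) - M t) * t⁻¹ ≤ a ^ 3 * fwdN M (a * t) := by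
    rw [← div_eq_mul_inv, div_le_iff₀ ht]
    calc _ ≤ a * (M (a * (a * t)) - M (a * t)) := h6
      _ ≤ a * (a * (a * t) * fwdN M (a * t)) := mul_le_mul_of_nonneg_left h8 ha0.le
      _ = _ := by ring
  have h10 : a ^ 3 ≤ 2 ^ 3 := pow_le_pow_left₀ ha0.le ha2 3
  nlinarith

lemma slow_of_doub {M : ℝ → ℝ} {D : ℝ} (hm : MonotoneOn M (Ioi 0)) (hD : 0 ≤ D)
    (hd : ∀ r > 0, M (2 * r) ≤ M r + D) : SlowG M (D * (1 + 2 / Real.log 2)) := by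
  refine ⟨hm, fun s t hs hst => ?_⟩
  have ht : 0 < t := hs.trans_le hst
  have hl2 : 0 < Real.log 2 := Real.log_pos (by norm_num)
  have h1 : ∀ n : ℕ, M (2 ^ n * s) ≤ M s + n * D := by
    intro n
    induction n with
    | zero => simp
    | succ k ih =>
      have := hd (2 ^ k * s) (by positivity)
      rw [pow_succ']
      push_cast
      rw [mul_assoc]
      linarith
  have hq : 1 ≤ t / s := (one_le_div hs).2 hst
  have hlog : 0 ≤ Real.logb 2 (t / s) := Real.logb_nonneg (by norm_num) hq
  set n := ⌈Real.logb 2 (t / s)⌉₊ with hn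
  have h2 : t / s ≤ 2 ^ n := by
    have := Nat.le_ceil (Real.logb 2 (t / s))
    rw [Real.logb_le_iff_le_rpow (by norm_num) (by positivity)] at this
    rwa [Real.rpow_natCast] at this
  have h3 : t ≤ 2 ^ n * s := (div_le_iff₀ hs).1 h2
  have h4 := hm ht (show (0:ℝ) < 2 ^ n * s by positivity) h3
  have h5 : (n : ℝ) ≤ Real.logb 2 (t / s) + 1 := (Nat.ceil_lt_add_one hlog).le
  have h6 : Real.log (t / s) ≤ (t / s) ^ (1/2 : ℝ) / (1/2) :=
    Real.log_le_rpow_div (by positivity) (by norm_num)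
  have h7 : (1:ℝ) ≤ (t / s) ^ (1/2 : ℝ) := Real.one_le_rpow hq (by norm_num)
  have h8 : (n : ℝ) ≤ (1 + 2 / Real.log 2) * (t / s) ^ (1/2 : ℝ) := by
    have : Real.logb 2 (t / s) ≤ 2 / Real.log 2 * (t / s) ^ (1/2 : ℝ) := by
      rw [Real.logb, div_le_iff₀ hl2]
      calc _ ≤ _ := h6
        _ = _ := by field_simp
    linarith
  have h9 := mul_le_mul_of_nonneg_left h8 hD
  have h10 := h1 n
  linarith

lemma prod_bound {M : ℝ → ℝ} {A : ℝ} (h : SlowG M A) {lam : ℝ} (hl : 3 ≤ lam) :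
    ∃ S : ℝ, ∀ t > 0,
      Summable (fun k : ℕ => ((2 : ℝ) ^ (k + 1))⁻¹ * (-M ((lam - 1) * (lam ^ (k + 2))⁻¹ * t))) ∧
      ∑' k : ℕ, ((2 : ℝ) ^ (k + 1))⁻¹ * (-M ((lam - 1) * (lam ^ (k + 2))⁻¹ * t)) ≤ S - M t := by
  have hl0 : 0 < lam := by linarith
  set L := A * lam ^ (1/2 : ℝ) with hL
  have hstep : ∀ s > 0, M (lam * s) ≤ M s + L := by
    intro s hs
    have := h.2 s (lam * s) hs (by nlinarith)
    rw [mul_div_cancel_right₀ _ hs.ne'] at this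
    linarith
  have hit : ∀ n : ℕ, ∀ s > 0, M (lam ^ n * s) ≤ M s + n * L := by
    intro n s hs
    induction n with
    | zero => simp
    | succ k ih =>
      have := hstep (lam ^ k * s) (by positivity)
      rw [pow_succ', mul_assoc]
      push_cast
      linarith
  have hgeo : HasSum (fun k : ℕ => ((2 : ℝ) ^ (k + 1))⁻¹) 1 := by
    have := hasSum_geometric_two' 1
    refine this.congr_fun fun k => ?_
    rw [pow_succ']; field_simp
  have hS : Summable (fun k : ℕ => ((2 : ℝ) ^ (k + 1))⁻¹ * (((k : ℝ) + 2) * L)) := by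
    have h1 := (summable_pow_mul_geometric_of_norm_lt_one (R := ℝ) 1 (r := 1/2) (by norm_num)).mul_left
      (L / 2)
    have h2 := hgeo.summable.mul_left (2 * L)
    refine (h1.add h2).congr fun k => ?_
    rw [pow_succ, one_div, inv_pow]
    field_simp
    ring
  refine ⟨∑' k : ℕ, ((2 : ℝ) ^ (k + 1))⁻¹ * (((k : ℝ) + 2) * L), fun t ht => ?_⟩
  have hb : ∀ k : ℕ, 0 ≤ M t - M ((lam - 1) * (lam ^ (k + 2))⁻¹ * t) ∧
      M t - M ((lam - 1) * (lam ^ (k + 2))⁻¹ * t) ≤ ((k : ℝ) + 2) * L := by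
    intro k
    have hp : 0 < lam ^ (k + 2) := by positivity
    have hl1 : 0 < lam - 1 := by linarith
    have hbt : 0 < (lam - 1) * (lam ^ (k + 2))⁻¹ * t := by positivity
    constructor
    · refine sub_nonneg.2 (h.1 hbt ht ?_)
      have : (lam - 1) * (lam ^ (k + 2))⁻¹ ≤ 1 := by
        rw [← div_eq_mul_inv, div_le_one hp]
        have : lam ^ 1 ≤ lam ^ (k + 2) := pow_le_pow_right₀ (by linarith) (by omega)
        linarith
      nlinarith
    · have h1 := hit (k + 2) ((lam ^ (k + 2))⁻¹ * t) (by positivity)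
      rw [mul_inv_cancel_left₀ hp.ne'] at h1
      have h2 : M ((lam ^ (k + 2))⁻¹ * t) ≤ M ((lam - 1) * (lam ^ (k + 2))⁻¹ * t) := by
        refine h.1 (show (0:ℝ) < _ by positivity) hbt ?_
        have : 0 < (lam ^ (k + 2))⁻¹ * t := by positivity
        nlinarith
      push_cast at h1
      linarith
  have hsum : Summable (fun k : ℕ =>
      ((2 : ℝ) ^ (k + 1))⁻¹ * (M t - M ((lam - 1) * (lam ^ (k + 2))⁻¹ * t))) :=
    Summable.of_nonneg_of_le (fun k => mul_nonneg (by positivity) (hb k).1)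
      (fun k => mul_le_mul_of_nonneg_left (hb k).2 (by positivity)) hS
  have hle := hsum.tsum_le_tsum
    (fun k => mul_le_mul_of_nonneg_left (hb k).2 (by positivity)) hS
  have hhs := hsum.hasSum.sub (hgeo.mul_right (M t))
  have hhs' : HasSum (fun k : ℕ => ((2 : ℝ) ^ (k + 1))⁻¹ * (-M ((lam - 1) * (lam ^ (k + 2))⁻¹ * t)))
      (∑' k : ℕ, ((2 : ℝ) ^ (k + 1))⁻¹ * (M t - M ((lam - 1) * (lam ^ (k + 2))⁻¹ * t)) - 1 * M t) := by
    refine hhs.congr_fun fun k => ?_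
    ring
  refine ⟨hhs'.summable, ?_⟩
  rw [hhs'.tsum_eq]
  linarith

/-- If `φ : (0,∞) → (0,∞)` is decreasing with `φ(0+) = ∞`, `φ(∞) = 0`
and `1/φ` doubling, then there exist a regular function `φ̄` and `c ≥ 1` with
`c⁻¹ φ̄(r) ≤ φ(r) ≤ c φ̄(r)` for all `r > 0`. -/
theorem statement3 (φ : ℝ → ℝ) (hpos : ∀ r > 0, 0 < φ r) (hdec : AntitoneOn φ (Ioi 0))
    (h0 : Filter.Tendsto φ (nhdsWithin 0 (Ioi 0)) Filter.atTop)
    (hinf : Filter.Tendsto φ Filter.atTop (nhds 0))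
    (hdoub : ∃ c > 0, ∀ r > 0, 1 / φ (2 * r) ≤ c * (1 / φ r)) :
    ∃ φb : ℝ → ℝ, IsRegularDecay φb ∧ ∃ c ≥ (1 : ℝ), ∀ r > 0,
      c⁻¹ * φb r ≤ φ r ∧ φ r ≤ c * φb r := by
  obtain ⟨c, hc, hdoub⟩ := hdoub
  set M : ℝ → ℝ := fun r => -Real.log (φ r) with hM
  have hMm : MonotoneOn M (Ioi 0) := fun s hs t ht hst =>
    neg_le_neg (Real.log_le_log (hpos t ht) (hdec hs ht hst))
  have hMφ : ∀ r > 0, φ r = Real.exp (-M r) := fun r hr => by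
    simp [hM, Real.exp_log (hpos r hr)]
  have hMd : ∀ r > 0, M (2 * r) ≤ M r + |Real.log c| := by
    intro r hr
    have h1 := hpos r hr
    have h2 := hpos (2 * r) (by linarith)
    have h3 := Real.log_le_log (by positivity) (hdoub r hr)
    rw [Real.log_mul hc.ne' (by positivity), one_div, one_div, Real.log_inv, Real.log_inv] at h3
    have := le_abs_self (Real.log c)
    simp only [hM]
    linarith
  have hG := slow_of_doub hMm (abs_nonneg _) hMd
  generalize |Real.log c| * (1 + 2 / Real.log 2) = A at hG
  have hG1 := hG.near (avg_mono hG) (fun t ht => avg_near hG ht)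
  have hc1 := avg_cont hG
  have hsc : ∀ t > 0, ∀ a ≥ 1, avg M (a * t) - avg M t ≤
    a * (avg M (a * (a * t)) - avg M (a * t)) := fun t ht a ha => avg_scaling hG ht ha
  have hn1 : ∀ t > 0, |avg M t - M t| ≤ 2 * A := fun t ht => avg_near hG ht
  generalize avg M = M1 at hG1 hc1 hsc hn1
  generalize hA1 : A + 2 * (2 * A) = A1 at hG1
  have hn2 : ∀ t > 0, |fwd M1 t - M1 t| ≤ 2 * A1 := fun t ht => fwd_near hG1 ht
  have hder : ∀ t > 0, HasDerivAt (fwd M1) (fwdN M1 t) t := fun t ht => fwd_hasDeriv hG1 hc1 ht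
  have hNc := fwdN_cont hG1 hc1
  have hNa := fwdN_anti hG1
  have hNd : ∀ t > 0, ∀ a ∈ Icc (1:ℝ) 2, fwdN M1 t ≤ 9 * fwdN M1 (a * t) :=
    fun t ht a ha => fwdN_doub hG1 hsc ht ha
  have hNp : ∀ t > 0, 0 < fwdN M1 t := by
    intro t ht
    obtain ⟨T, hT1, hT2⟩ := ((hinf.eventually (gt_mem_nhds
      (Real.exp_pos (-(M1 t + 2 * A))))).and (Filter.eventually_ge_atTop t)).exists
    have hT0 : 0 < T := ht.trans_le hT2
    rw [hMφ T hT0, Real.exp_lt_exp] at hT1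
    have h1 := abs_le.1 (hn1 T hT0)
    have h2 := fwdN_lower hG1 ht hT2
    have h3 : 0 < (M1 T - M1 t) * T⁻¹ := mul_pos (by linarith) (by positivity)
    linarith
  have hn : ∀ t > 0, |fwd M1 t - M t| ≤ 2 * A1 + 2 * A := by
    intro t ht
    have h1 := abs_le.1 (hn1 t ht)
    have h2 := abs_le.1 (hn2 t ht)
    rw [abs_le]
    constructor <;> linarith
  generalize fwd M1 = M2 at hn2 hder hn
  generalize fwdN M1 = N at hder hNc hNa hNd hNp
  generalize 2 * A1 + 2 * A = K at hn
  have hK : 0 ≤ K := (abs_nonneg _).trans (hn 1 one_pos)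
  have hM2s : StrictMonoOn M2 (Ioi 0) := by
    refine strictMonoOn_of_deriv_pos (convex_Ioi 0)
      (fun t ht => (hder t ht).continuousAt.continuousWithinAt) fun t ht => ?_
    rw [interior_Ioi] at ht
    rw [(hder t ht).deriv]
    exact hNp t ht
  have hG2 := hG.near hM2s.monotoneOn hn
  have hcomp : ∀ r > 0, (Real.exp K)⁻¹ * Real.exp (-M2 r) ≤ φ r ∧
      φ r ≤ Real.exp K * Real.exp (-M2 r) := by
    intro r hr
    have := abs_le.1 (hn r hr)
    rw [hMφ r hr, ← Real.exp_neg, ← Real.exp_add, ← Real.exp_add, Real.exp_le_exp, Real.exp_le_exp]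
    constructor <;> linarith
  have hEK := Real.exp_pos K
  have hlogd : ∀ t > 0, deriv (fun s => -Real.log (Real.exp (-M2 s))) t = N t := by
    intro t ht
    simp only [Real.log_exp, neg_neg]
    exact (hder t ht).deriv
  have hdφ : ∀ t > 0, HasDerivAt (fun s => Real.exp (-M2 s)) (Real.exp (-M2 t) * -N t) t :=
    fun t ht => (hder t ht).neg.exp
  refine ⟨fun r => Real.exp (-M2 r), ⟨?_, ?_, ?_, ?_, ?_, ?_, ?_, ?_, ?_⟩,
    Real.exp K, Real.one_le_exp hK, hcomp⟩
  · intro s hs t ht hst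
    exact Real.exp_lt_exp.2 (neg_lt_neg (hM2s hs ht hst))
  · exact fun r _ => Real.exp_pos _
  · exact fun r hr => (hdφ r hr).differentiableAt
  · have : ContinuousOn (fun t => Real.exp (-M2 t) * -N t) (Ioi 0) :=
      ContinuousOn.mul (fun t ht => (hdφ t ht).continuousAt.continuousWithinAt) hNc.neg
    exact this.congr fun t ht => (hdφ t ht).deriv
  · have h1 : Filter.Tendsto (fun r => (Real.exp K)⁻¹ * φ r) (nhdsWithin 0 (Ioi 0)) Filter.atTop :=
      h0.const_mul_atTop (by positivity)
    refine Filter.tendsto_atTop_mono' _ ?_ h1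
    filter_upwards [self_mem_nhdsWithin] with r hr
    rw [inv_mul_le_iff₀ hEK]
    exact (hcomp r hr).2
  · have h1 : Filter.Tendsto (fun r => Real.exp K * φ r) Filter.atTop (nhds 0) := by
      simpa using hinf.const_mul (Real.exp K)
    refine squeeze_zero' (Filter.Eventually.of_forall fun r => (Real.exp_pos _).le) ?_ h1
    filter_upwards [Filter.eventually_gt_atTop 0] with r hr
    rw [← inv_mul_le_iff₀ hEK]
    exact (hcomp r hr).1
  · refine ⟨1, le_rfl, N, hNp, hNa, fun t ht => ?_⟩
    rw [hlogd t ht]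
    simp
  · refine ⟨9, by norm_num, fun t ht a ha => ?_⟩
    rw [hlogd t ht, hlogd (a * t) (mul_pos (by linarith [ha.1]) ht)]
    exact hNd t ht a ha
  · refine ⟨3, by norm_num, fun lam hl => ?_⟩
    obtain ⟨S, hS⟩ := prod_bound hG2 hl
    refine ⟨1, one_pos, Real.exp S, Real.exp_pos _, fun t ht => ?_⟩
    simp only [Real.log_exp, one_mul]
    refine ⟨(hS t ht).1, ?_⟩
    rw [← Real.exp_add, Real.exp_le_exp]
    linarith [(hS t ht).2]
end

section
/- Let φ be a strictly decreasing differentiable bijection of (0,∞) onto (0,∞) satisfying condition (D). Define θ(r) := −φ'(φ⁻¹(r)) and θ̃(r) := sup_{t>0} (r/t) log(r/φ(t)) for r > 0. Then there is a constant c > 0 such that θ̃(r) ≥ c θ(r) for all r > 0. -/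
open Set

/-- Let `φ` be a strictly decreasing differentiable bijection of `(0,∞)`
onto `(0,∞)` satisfying condition (D) (with `M(t) = −log φ(t)`, there is `λ > 0` with
`M'(s) ≥ λ M'(t)` for all `t > 0`, `s ∈ [t,2t]`). With `θ(r) = −φ'(φ⁻¹(r))` and
`θ̃(r) = sup_{t>0} (r/t) log(r/φ(t))` (supremum in `[0,∞]`), there is `c > 0` with
`θ̃(r) ≥ c θ(r)` for all `r > 0`. -/
theorem statement4 (φ φinv : ℝ → ℝ)
    (hpos : ∀ r > 0, 0 < φ r) (hanti : StrictAntiOn φ (Ioi 0))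
    (hdiff : ∀ r > 0, DifferentiableAt ℝ φ r)
    (hinv_pos : ∀ r > 0, 0 < φinv r)
    (hinv_left : ∀ r > 0, φinv (φ r) = r)
    (hinv_right : ∀ r > 0, φ (φinv r) = r)
    (hD : ∃ lam > (0 : ℝ), ∀ t > 0, ∀ s ∈ Icc t (2 * t),
      lam * deriv (fun u => -Real.log (φ u)) t ≤ deriv (fun u => -Real.log (φ u)) s) :
    ∃ c > (0 : ℝ), ∀ r > 0,
      ENNReal.ofReal (c * -deriv φ (φinv r)) ≤
        ⨆ t : {t : ℝ // 0 < t}, ENNReal.ofReal ((r / t) * Real.log (r / φ t)) := by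
  obtain ⟨lam, hlam, hD⟩ := hD
  refine ⟨lam / 2, by positivity, fun r hr => ?_⟩
  have ht := hinv_pos r hr
  have hφ := hinv_right r hr
  set t := φinv r with htdef
  have hM : ∀ u > 0, HasDerivAt (fun u => -Real.log (φ u)) (-(deriv φ u / φ u)) u :=
    fun u hu => ((hdiff u hu).hasDerivAt.log (hpos u hu).ne').neg
  obtain ⟨s, hs, hseq⟩ := exists_deriv_eq_slope (fun u => -Real.log (φ u))
    (show t < 2 * t by linarith)
    (fun u hu => (hM u (by linarith [hu.1])).continuousAt.continuousWithinAt)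
    (fun u hu => (hM u (by linarith [hu.1])).differentiableAt.differentiableWithinAt)
  have h1 := hD t ht s ⟨hs.1.le, hs.2.le⟩
  rw [hseq, (hM t ht).deriv, hφ] at h1
  have h2t : 0 < φ (2 * t) := hpos _ (by linarith)
  refine le_trans (ENNReal.ofReal_le_ofReal ?_)
    (le_iSup (fun t : {t : ℝ // 0 < t} => ENNReal.ofReal ((r / t) * Real.log (r / φ t)))
      ⟨2 * t, by linarith⟩)
  simp only
  rw [Real.log_div hr.ne' h2t.ne']
  have h2 := mul_le_mul_of_nonneg_left h1 (show 0 ≤ r / 2 by positivity)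
  calc lam / 2 * -deriv φ t = r / 2 * (lam * -(deriv φ t / r)) := by field_simp
    _ ≤ _ := h2
    _ = _ := by
      rw [show 2 * t - t = t by ring]
      field_simp
      ring
end

section
/- Let d ≥ 1 be an integer, let c > 0, and let φ : (0,∞) → (0,∞) be a strictly increasing function with ∫_0^1 u/φ(u) du < ∞. Let J : ℝ^d × ℝ^d → [0,∞) be a measurable function with J(z, w) ≤ c / (|z−w|^d φ(|z−w|)) for all z ≠ w. For x₀ ∈ ℝ^d, m > 0 and s > 0, define ψ(z) := (s/3) · min(|z − x₀|, m), and for ρ > 0 define Φ(ρ) := ρ² / (2 ∫_0^ρ u/φ(u) du). Then there is a constant c₆ > 0 depending only on d and c such that for all s, ρ, m > 0, all x₀ ∈ ℝ^d and all z ∈ ℝ^d: (1/2) ∫_{{w : 0 < |z−w| ≤ ρ}} (e^{ψ(z) − ψ(w)} − 1)² J(z, w) dw ≤ c₆ e^{s ρ} / Φ(ρ). -/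
open Set MeasureTheory ENNReal

lemma aux_exp (a b : ℝ) (h : |a| ≤ b) : (Real.exp a - 1) ^ 2 ≤ a ^ 2 * Real.exp (2 * b) := by
  have h1 : |Real.exp a - 1| ≤ |a| * Real.exp |a| := by
    rcases le_total 0 a with ha | ha
    · rw [abs_of_nonneg ha, abs_of_nonneg (by linarith [Real.one_le_exp ha])]
      have h2 := Real.add_one_le_exp (-a)
      have h3 : Real.exp (-a) * Real.exp a = 1 := by rw [← Real.exp_add]; simp
      nlinarith [Real.exp_pos a]
    · have h4 : Real.exp a ≤ 1 := Real.exp_le_one_iff.2 ha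
      rw [abs_of_nonpos (by linarith), abs_of_nonpos ha]
      have h2 := Real.add_one_le_exp a
      have h3 : 1 ≤ Real.exp (-a) := Real.one_le_exp (by linarith)
      nlinarith
  have h2 : |Real.exp a - 1| ^ 2 ≤ (|a| * Real.exp b) ^ 2 := by
    gcongr
    exact h1.trans (by gcongr)
  rw [sq_abs, mul_pow, sq_abs, ← Real.exp_nat_mul] at h2
  exact_mod_cast h2

lemma aux_int (φ : ℝ → ℝ) (hφ : ∀ r > 0, 0 < φ r) (hm : StrictMonoOn φ (Ioi 0))
    (h1 : (∫⁻ u in Ioc (0 : ℝ) 1, ENNReal.ofReal (u / φ u)) < ∞) (ρ : ℝ) :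
    IntegrableOn (fun u => u / φ u) (Ioc 0 ρ) := by
  have hme : AEStronglyMeasurable (fun u => u / φ u) (volume.restrict (Ioi (0:ℝ))) := by
    have := aemeasurable_restrict_of_monotoneOn (μ := (volume : Measure ℝ)) measurableSet_Ioi
      hm.monotoneOn
    exact (aemeasurable_id.div this).aestronglyMeasurable
  have hA : IntegrableOn (fun u => u / φ u) (Ioc 0 1) := by
    refine ⟨hme.mono_measure (Measure.restrict_mono Ioc_subset_Ioi_self le_rfl), ?_⟩
    rw [hasFiniteIntegral_iff_ofReal]
    · exact h1
    · filter_upwards [ae_restrict_mem measurableSet_Ioc] with u hu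
      exact div_nonneg hu.1.le (hφ u hu.1).le
  have hB : IntegrableOn (fun u => u / φ u) (Ioc 1 ρ) := by
    refine Integrable.mono' (integrable_const (ρ / φ 1))
      (hme.mono_measure (Measure.restrict_mono (fun x hx => ?_) le_rfl)) ?_
    · exact lt_trans one_pos hx.1
    · filter_upwards [ae_restrict_mem measurableSet_Ioc] with u hu
      have hu0 : 0 < u := lt_trans one_pos hu.1
      rw [Real.norm_of_nonneg (div_nonneg hu0.le (hφ u hu0).le)]
      have := hm (mem_Ioi.2 one_pos) (mem_Ioi.2 hu0) hu.1
      exact div_le_div₀ (hu0.le.trans hu.2) hu.2 (hφ 1 one_pos) this.le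
  refine (hA.union hB).mono_set fun x hx => ?_
  rcases le_or_gt x 1 with h | h
  · exact Or.inl ⟨hx.1, h⟩
  · exact Or.inr ⟨h, hx.2⟩

lemma aux_polar (d : ℕ) (hd : 1 ≤ d) (φ : ℝ → ℝ) (ρ : ℝ)
    (hi : IntegrableOn (fun u => u / φ u) (Ioc 0 ρ)) :
    Integrable (fun w : EuclideanSpace ℝ (Fin d) =>
      (Ioc 0 ρ).indicator (fun t => t ^ 2 / (t ^ d * φ t)) ‖w‖) ∧
    ∫ w : EuclideanSpace ℝ (Fin d), (Ioc 0 ρ).indicator (fun t => t ^ 2 / (t ^ d * φ t)) ‖w‖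
      = d * volume.real (Metric.ball (0 : EuclideanSpace ℝ (Fin d)) 1)
        * ∫ u in Ioc (0 : ℝ) ρ, u / φ u := by
  have : Nonempty (Fin d) := ⟨⟨0, hd⟩⟩
  have key : ∀ y ∈ Ioi (0:ℝ), y ^ (d - 1) • (Ioc 0 ρ).indicator (fun t => t ^ 2 / (t ^ d * φ t)) y
      = (Ioc 0 ρ).indicator (fun u => u / φ u) y := by
    intro y hy
    have hy0 : y ≠ 0 := (ne_of_gt hy)
    by_cases h : y ∈ Ioc 0 ρ
    · rw [indicator_of_mem h, indicator_of_mem h, smul_eq_mul]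
      obtain ⟨k, rfl⟩ : ∃ k, d = k + 1 := ⟨d - 1, by omega⟩
      simp only [Nat.add_sub_cancel]
      rw [← mul_div_assoc, show y ^ k * y ^ 2 = y ^ (k + 1) * y by ring,
        mul_div_mul_left _ _ (by positivity)]
    · simp [indicator_of_notMem h]
  constructor
  · rw [integrable_fun_norm_addHaar (μ := volume), finrank_euclideanSpace_fin,
      integrableOn_congr_fun key measurableSet_Ioi]
    exact ((integrable_indicator_iff measurableSet_Ioc).2 hi).integrableOn
  · rw [integral_fun_norm_addHaar, finrank_euclideanSpace_fin,
      setIntegral_congr_fun measurableSet_Ioi key, setIntegral_indicator measurableSet_Ioc,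
      inter_eq_self_of_subset_right Ioc_subset_Ioi_self]
    simp [mul_assoc]

/-- Let `d ≥ 1` and `c > 0`. There is `c₆ > 0` depending only on `d` and `c`
such that: whenever `φ : (0,∞) → (0,∞)` is strictly increasing with `∫_0^1 u/φ(u) du < ∞`,
`J : ℝ^d × ℝ^d → [0,∞)` satisfies `J(z,w) ≤ c/(|z−w|^d φ(|z−w|))` for `z ≠ w`, and
`ψ(z) = (s/3) min(|z − x₀|, m)`, `Φ(ρ) = ρ²/(2 ∫_0^ρ u/φ(u) du)`, then for all
`s, ρ, m > 0`, `x₀` and `z`: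
`(1/2) ∫_{0<|z−w|≤ρ} (e^{ψ(z)−ψ(w)} − 1)² J(z,w) dw ≤ c₆ e^{sρ}/Φ(ρ)`. -/
theorem statement16 (d : ℕ) (hd : 1 ≤ d) (c : ℝ) (hc : 0 < c) :
    ∃ c₆ > (0 : ℝ), ∀ φ : ℝ → ℝ, (∀ r > 0, 0 < φ r) → StrictMonoOn φ (Ioi 0) →
      (∫⁻ u in Ioc (0 : ℝ) 1, ENNReal.ofReal (u / φ u)) < ∞ →
      ∀ J : EuclideanSpace ℝ (Fin d) → EuclideanSpace ℝ (Fin d) → ℝ,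
        (∀ z w, 0 ≤ J z w) →
        (∀ z w, z ≠ w → J z w ≤ c / (‖z - w‖ ^ d * φ ‖z - w‖)) →
        ∀ s ρ m : ℝ, 0 < s → 0 < ρ → 0 < m →
          ∀ x₀ z : EuclideanSpace ℝ (Fin d),
            2⁻¹ * ∫⁻ w in {w : EuclideanSpace ℝ (Fin d) | 0 < dist z w ∧ dist z w ≤ ρ},
                ENNReal.ofReal
                  ((Real.exp (s / 3 * min ‖z - x₀‖ m - s / 3 * min ‖w - x₀‖ m) - 1) ^ 2
                    * J z w)
              ≤ ENNReal.ofReal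
                  (c₆ * Real.exp (s * ρ) / (ρ ^ 2 / (2 * ∫ u in Ioc (0 : ℝ) ρ, u / φ u))) := by
  have : Nonempty (Fin d) := ⟨⟨0, hd⟩⟩
  set V : ℝ := volume.real (Metric.ball (0 : EuclideanSpace ℝ (Fin d)) 1) with hV
  have hVpos : 0 < V :=
    ENNReal.toReal_pos (Metric.measure_ball_pos _ _ one_pos).ne' measure_ball_lt_top.ne
  have hd0 : (0:ℝ) < d := by exact_mod_cast hd
  refine ⟨c * (d * V), by positivity, ?_⟩
  intro φ hφ hm h1 J hJ0 hJ s ρ m hs hρ hmm x₀ z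
  have hi := aux_int φ hφ hm h1 ρ
  obtain ⟨hgi, hg⟩ := aux_polar d hd φ ρ hi
  set g : ℝ → ℝ := (Ioc 0 ρ).indicator (fun t => t ^ 2 / (t ^ d * φ t)) with hgdef
  set I : ℝ := ∫ u in Ioc (0 : ℝ) ρ, u / φ u with hI
  have hI0 : 0 ≤ I := setIntegral_nonneg measurableSet_Ioc
    fun u hu => div_nonneg hu.1.le (hφ u hu.1).le
  have hg0 : ∀ t, 0 ≤ g t := fun t => indicator_nonneg
    (fun u hu => div_nonneg (sq_nonneg _) (mul_nonneg (pow_nonneg hu.1.le _) (hφ u hu.1).le)) t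
  set K : ℝ := (s / 3) ^ 2 * Real.exp (2 * (s / 3 * ρ)) * c with hK
  have hK0 : 0 ≤ K := by positivity
  have hset : MeasurableSet {w : EuclideanSpace ℝ (Fin d) | 0 < dist z w ∧ dist z w ≤ ρ} :=
    have hdm : Measurable fun w : EuclideanSpace ℝ (Fin d) => dist z w := by fun_prop
    hdm measurableSet_Ioc
  have hbound : ∫⁻ w in {w : EuclideanSpace ℝ (Fin d) | 0 < dist z w ∧ dist z w ≤ ρ},
                ENNReal.ofReal
                  ((Real.exp (s / 3 * min ‖z - x₀‖ m - s / 3 * min ‖w - x₀‖ m) - 1) ^ 2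
                    * J z w) ≤ ENNReal.ofReal (K * (d * V * I)) := by
    calc _ ≤ ∫⁻ w in {w : EuclideanSpace ℝ (Fin d) | 0 < dist z w ∧ dist z w ≤ ρ},
              ENNReal.ofReal (K * g ‖z - w‖) := by
          refine setLIntegral_mono' hset fun w hw => ENNReal.ofReal_le_ofReal ?_
          obtain ⟨hw0, hw1⟩ := hw
          have hne : z ≠ w := dist_pos.1 hw0
          rw [dist_eq_norm] at hw0 hw1
          have hj := hJ z w hne
          set t := ‖z - w‖ with ht
          have hgt : g t = t ^ 2 / (t ^ d * φ t) := by
            rw [hgdef, indicator_of_mem (mem_Ioc.2 ⟨hw0, hw1⟩)]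
          have hl : |min ‖z - x₀‖ m - min ‖w - x₀‖ m| ≤ t := by
            refine (abs_min_sub_min_le_max _ _ _ _).trans ?_
            rw [sub_self, abs_zero]
            refine max_le ((abs_norm_sub_norm_le _ _).trans ?_) hw0.le
            rw [sub_sub_sub_cancel_right]
          have ha : |s / 3 * min ‖z - x₀‖ m - s / 3 * min ‖w - x₀‖ m| ≤ s / 3 * t := by
            rw [← mul_sub, abs_mul, abs_of_pos (by positivity : 0 < s / 3)]
            gcongr
          have he := aux_exp _ (s / 3 * ρ) (ha.trans (by gcongr))
          have hsq := sq_le_sq' (by linarith [neg_abs_le (s / 3 * min ‖z - x₀‖ m - s / 3 * min ‖w - x₀‖ m)]) ((le_abs_self _).trans ha)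
          calc _ ≤ ((s / 3 * t) ^ 2 * Real.exp (2 * (s / 3 * ρ))) * (c / (t ^ d * φ t)) := by
                refine mul_le_mul (he.trans ?_) hj (hJ0 _ _) (by positivity)
                gcongr
            _ = K * g t := by rw [hgt, hK]; ring
      _ ≤ ∫⁻ w : EuclideanSpace ℝ (Fin d), ENNReal.ofReal (K * g ‖z - w‖) :=
          setLIntegral_le_lintegral _ _
      _ = ∫⁻ w : EuclideanSpace ℝ (Fin d), ENNReal.ofReal (K * g ‖w‖) :=
          lintegral_sub_left_eq_self (fun w => ENNReal.ofReal (K * g ‖w‖)) z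
      _ = ENNReal.ofReal (∫ w : EuclideanSpace ℝ (Fin d), K * g ‖w‖) :=
          (ofReal_integral_eq_lintegral_ofReal (hgi.const_mul K)
            (Filter.Eventually.of_forall fun w => mul_nonneg hK0 (hg0 _))).symm
      _ = _ := by rw [integral_const_mul, hg]
  calc _ ≤ 2⁻¹ * ENNReal.ofReal (K * (d * V * I)) := by gcongr
    _ ≤ 1 * ENNReal.ofReal (K * (d * V * I)) := by gcongr; simp
    _ ≤ _ := by
      rw [one_mul]
      refine ENNReal.ofReal_le_ofReal ?_
      have hx : 0 ≤ s / 3 * ρ := by positivity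
      have hq := Real.quadratic_le_exp_of_nonneg hx
      have hsplit : Real.exp (s * ρ) = Real.exp (s / 3 * ρ) * Real.exp (2 * (s / 3 * ρ)) := by
        rw [← Real.exp_add]; congr 1; ring
      have hfin : (s / 3) ^ 2 * Real.exp (2 * (s / 3 * ρ)) * ρ ^ 2 ≤ 2 * Real.exp (s * ρ) := by
        rw [hsplit]
        nlinarith [Real.exp_pos (2 * (s / 3 * ρ))]
      rw [div_div_eq_mul_div, le_div_iff₀ (by positivity)]
      calc K * (d * V * I) * ρ ^ 2
          = (c * (d * V) * I) * ((s / 3) ^ 2 * Real.exp (2 * (s / 3 * ρ)) * ρ ^ 2) := by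
            rw [hK]; ring
        _ ≤ (c * (d * V) * I) * (2 * Real.exp (s * ρ)) := by gcongr
        _ = _ := by ring
end
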